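/- On the Cartan group, the composition of the Rumin differential d_c^{(1)}: E_0^1 → E_0^2 with d_c^{(2)}: E_0^2 → E_0^3 vanishes: the product of the 3×3 matrix of second-order operators [[-X_1X_2 - X_3, (1/√2)X_1², 0], [-(1/√2)X_2², -(3/2)X_3, (1/√2)X_1²], [0, -(1/√2)X_2², X_2X_1 - X_3]] with the 3×2 matrix [[-X_1²X_2 - X_1X_3 - X_4, X_1³], [-√2(X_1X_2² + X_5), √2(X_2X_1² - X_4)], [-X_2³, X_2²X_1 - X_2X_3 - X_5]] is the zero 3×2 matrix of differential operators (as operators on smooth functions). -/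

import Mathlib

noncomputable section

/-- Points of the Cartan group, identified with `ℝ^5`. -/
abbrev Pt : Type := Fin 5 → ℝ

/-- Partial derivative in the `i`-th coordinate direction. -/
noncomputable def pd (i : Fin 5) (f : Pt → ℝ) : Pt → ℝ :=
  fun x => fderiv ℝ f x (Pi.single i 1)

/-- `X₁ = ∂₁`. -/
noncomputable def X1 (f : Pt → ℝ) : Pt → ℝ := pd 0 f

/-- `X₂ = ∂₂ + x₁∂₃ + (x₁²/2)∂₄ + x₁x₂∂₅`. -/
noncomputable def X2 (f : Pt → ℝ) : Pt → ℝ :=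
  fun x => pd 1 f x + x 0 * pd 2 f x + (x 0) ^ 2 / 2 * pd 3 f x + x 0 * x 1 * pd 4 f x

/-- `X₃ = ∂₃ + x₁∂₄ + x₂∂₅`. -/
noncomputable def X3 (f : Pt → ℝ) : Pt → ℝ :=
  fun x => pd 2 f x + x 0 * pd 3 f x + x 1 * pd 4 f x

/-- `X₄ = ∂₄`. -/
noncomputable def X4 (f : Pt → ℝ) : Pt → ℝ := pd 3 f

/-- `X₅ = ∂₅`. -/
noncomputable def X5 (f : Pt → ℝ) : Pt → ℝ := pd 4 f
/-- The Rumin differential `d_c^{(1)} : E₀¹ → E₀²` of the Cartan group,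
as a 3×2 matrix of third-order left-invariant differential operators. -/
noncomputable def dc1 : Fin 3 → Fin 2 → (Pt → ℝ) → Pt → ℝ :=
  ![![fun u x => -(X1 (X1 (X2 u)) x) - X1 (X3 u) x - X4 u x,
     fun u x => X1 (X1 (X1 u)) x],
    ![fun u x => -Real.sqrt 2 * (X1 (X2 (X2 u)) x + X5 u x),
     fun u x => Real.sqrt 2 * (X2 (X1 (X1 u)) x - X4 u x)],
    ![fun u x => -(X2 (X2 (X2 u)) x),
     fun u x => X2 (X2 (X1 u)) x - X2 (X3 u) x - X5 u x]]

/-- The Rumin differential `d_c^{(2)} : E₀² → E₀³` of the Cartan group,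
as a 3×3 matrix of second-order left-invariant differential operators. -/
noncomputable def dc2 : Fin 3 → Fin 3 → (Pt → ℝ) → Pt → ℝ :=
  ![![fun u x => -(X1 (X2 u) x) - X3 u x,
     fun u x => (1 / Real.sqrt 2) * X1 (X1 u) x,
     fun _ _ => 0],
    ![fun u x => -(1 / Real.sqrt 2) * X2 (X2 u) x,
     fun u x => -(3 / 2) * X3 u x,
     fun u x => (1 / Real.sqrt 2) * X1 (X1 u) x],
    ![fun _ _ => 0,
     fun u x => -(1 / Real.sqrt 2) * X2 (X2 u) x,
     fun u x => X2 (X1 u) x - X3 u x]]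

/-- The Rumin differential `d_c^{(3)} : E₀³ → E₀⁴` of the Cartan group,
as a 2×3 matrix of third-order left-invariant differential operators. -/
noncomputable def dc3 : Fin 2 → Fin 3 → (Pt → ℝ) → Pt → ℝ :=
  ![![fun u x => X1 (X2 (X2 u)) x + X3 (X2 u) x - X5 u x,
     fun u x => Real.sqrt 2 * (-(X1 (X1 (X2 u)) x) + X4 u x),
     fun u x => X1 (X1 (X1 u)) x],
    ![fun u x => X2 (X2 (X2 u)) x,
     fun u x => -Real.sqrt 2 * (X2 (X2 (X1 u)) x + X5 u x),
     fun u x => X2 (X1 (X1 u)) x - X3 (X1 u) x + X4 u x]]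

open scoped ContDiff

section PartialDerivatives

variable {f g : Pt → ℝ}

theorem ContDiff.pd (hf : ContDiff ℝ ∞ f) (i : Fin 5) : ContDiff ℝ ∞ (pd i f) :=
  (hf.fderiv_right (m := ∞) le_rfl).clm_apply contDiff_const

theorem pd_add (hf : ContDiff ℝ ∞ f) (hg : ContDiff ℝ ∞ g) (i : Fin 5) :
    pd i (fun x => f x + g x) = fun x => pd i f x + pd i g x := by
  funext x
  simp only [_root_.pd]
  rw [fderiv_fun_add (hf.differentiable (by simp) x) (hg.differentiable (by simp) x)]
  rfl

theorem pd_mul (hf : ContDiff ℝ ∞ f) (hg : ContDiff ℝ ∞ g) (i : Fin 5) :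
    pd i (fun x => f x * g x) = fun x => f x * pd i g x + g x * pd i f x := by
  funext x
  simp only [_root_.pd]
  rw [fderiv_fun_mul (hf.differentiable (by simp) x) (hg.differentiable (by simp) x)]
  rfl

theorem pd_const (r : ℝ) (i : Fin 5) : pd i (fun _ => r) = fun _ => 0 := by
  funext x
  simp [pd]

theorem pd_coord (i j : Fin 5) :
    pd i (fun x => x j) = fun _ => (Pi.single i 1 : Pt) j := by
  funext x
  simp only [pd]
  rw [(hasFDerivAt_apply j x).fderiv]
  rfl

theorem pd_comm (hf : ContDiff ℝ ∞ f) (i j : Fin 5) : pd i (pd j f) = pd j (pd i f) := by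
  have hdf : Differentiable ℝ (fderiv ℝ f) :=
    (hf.fderiv_right (m := ∞) le_rfl).differentiable (by simp)
  have second (k l : Fin 5) (x : Pt) :
      pd k (pd l f) x = fderiv ℝ (fderiv ℝ f) x (Pi.single k 1) (Pi.single l 1) := by
    change fderiv ℝ (fun y => fderiv ℝ f y (Pi.single l 1)) x (Pi.single k 1) = _
    rw [fderiv_clm_apply (hdf x) (differentiableAt_const _)]
    simp
  funext x
  rw [second, second]
  have h2 : ContDiff ℝ 2 f := contDiff_infty.1 hf 2
  exact (h2.contDiffAt.isSymmSndFDerivAt (by simp)) _ _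

end PartialDerivatives

/-- The space of smooth functions on the Cartan group. -/
def smoothFunctions : Submodule ℝ (Pt → ℝ) where
  carrier := {f | ContDiff ℝ ∞ f}
  add_mem' {_ _} (hf : ContDiff ℝ ∞ _) (hg : ContDiff ℝ ∞ _) := hf.add hg
  zero_mem' := show ContDiff ℝ ∞ _ from contDiff_const
  smul_mem' _ _ (hf : ContDiff ℝ ∞ _) := contDiff_const.smul hf

/-- Partial differentiation as an endomorphism of the space of smooth functions. -/
def pdEnd (i : Fin 5) : Module.End ℝ smoothFunctions where
  toFun f := ⟨pd i f, ContDiff.pd f.2 i⟩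
  map_add' f g := Subtype.ext (pd_add f.2 g.2 i)
  map_smul' r f := Subtype.ext <| by
    have h := pd_mul (contDiff_const (c := r)) f.2 i
    simp only [pd_const, mul_zero, add_zero] at h
    exact h

/-- Multiplication by a coordinate as an endomorphism of the space of smooth functions. -/
def coordEnd (j : Fin 5) : Module.End ℝ smoothFunctions where
  toFun f := ⟨fun x => x j * (f : Pt → ℝ) x,
    ContDiff.mul (contDiff_apply ℝ ℝ j) (show ContDiff ℝ ∞ f from f.2)⟩
  map_add' _ _ := Subtype.ext <| funext fun _ => mul_add _ _ _
  map_smul' _ _ := Subtype.ext <| funext fun _ => mul_left_comm _ _ _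

theorem pdEnd_mul_comm (i j : Fin 5) : pdEnd i * pdEnd j = pdEnd j * pdEnd i :=
  LinearMap.ext fun f => Subtype.ext (pd_comm f.2 i j)

theorem coordEnd_mul_comm (i j : Fin 5) : coordEnd i * coordEnd j = coordEnd j * coordEnd i :=
  LinearMap.ext fun _ => Subtype.ext <| funext fun _ => mul_left_comm _ _ _

theorem pdEnd_mul_coordEnd_self (i : Fin 5) :
    pdEnd i * coordEnd i = coordEnd i * pdEnd i + 1 := by
  refine LinearMap.ext fun f => Subtype.ext ?_
  refine (pd_mul (contDiff_apply ℝ ℝ i) f.2 i).trans ?_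
  rw [pd_coord]
  funext x
  simp [coordEnd, pdEnd]

theorem pdEnd_mul_coordEnd_of_ne {i j : Fin 5} (h : j ≠ i) :
    pdEnd i * coordEnd j = coordEnd j * pdEnd i := by
  refine LinearMap.ext fun f => Subtype.ext ?_
  refine (pd_mul (contDiff_apply ℝ ℝ j) f.2 i).trans ?_
  rw [pd_coord]
  funext x
  simp [coordEnd, pdEnd, h]

/-- `X₂` as an endomorphism of the space of smooth functions. -/
def X2End : Module.End ℝ smoothFunctions :=
  pdEnd 1 + coordEnd 0 * pdEnd 2 + (1 / 2 : ℝ) • (coordEnd 0 * (coordEnd 0 * pdEnd 3)) +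
    coordEnd 0 * (coordEnd 1 * pdEnd 4)

/-- `X₃` as an endomorphism of the space of smooth functions. -/
def X3End : Module.End ℝ smoothFunctions :=
  pdEnd 2 + coordEnd 0 * pdEnd 3 + coordEnd 1 * pdEnd 4

theorem X1_coe (f : smoothFunctions) : X1 f = (pdEnd 0 f : smoothFunctions) := rfl

theorem X2_coe (f : smoothFunctions) : X2 f = (X2End f : smoothFunctions) := by
  funext x
  simp [X2, X2End, pdEnd, coordEnd]
  ring

theorem X3_coe (f : smoothFunctions) : X3 f = (X3End f : smoothFunctions) := rfl

theorem X4_coe (f : smoothFunctions) : X4 f = (pdEnd 3 f : smoothFunctions) := rfl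

theorem X5_coe (f : smoothFunctions) : X5 f = (pdEnd 4 f : smoothFunctions) := rfl

theorem mul_mul_eq_of_mul_eq {M : Type*} [Semigroup M] {a b c : M} (h : a * b = c) (z : M) :
    a * (b * z) = c * z := by
  rw [← mul_assoc, h]

theorem X2End_mul_X1 : X2End * pdEnd 0 = pdEnd 0 * X2End - X3End := by
  have h0 := mul_mul_eq_of_mul_eq (pdEnd_mul_coordEnd_self 0)
  have h1 := mul_mul_eq_of_mul_eq (pdEnd_mul_coordEnd_of_ne (i := 0) (j := 1) (by decide))
  simp only [X2End, X3End, mul_add, add_mul, mul_smul_comm, smul_mul_assoc, mul_assoc, h0, h1,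
    one_mul, pdEnd_mul_comm 0]
  module

theorem X3End_mul_X1 : X3End * pdEnd 0 = pdEnd 0 * X3End - pdEnd 3 := by
  have h0 := mul_mul_eq_of_mul_eq (pdEnd_mul_coordEnd_self 0)
  have h1 := mul_mul_eq_of_mul_eq (pdEnd_mul_coordEnd_of_ne (i := 0) (j := 1) (by decide))
  simp only [X3End, mul_add, add_mul, mul_assoc, h0, h1, one_mul, pdEnd_mul_comm 0]
  module

theorem pdEnd_mul_X2End {i : Fin 5} (h0 : 0 ≠ i) (h1 : 1 ≠ i) :
    pdEnd i * X2End = X2End * pdEnd i := by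
  have c0 := mul_mul_eq_of_mul_eq (pdEnd_mul_coordEnd_of_ne h0)
  have c1 := mul_mul_eq_of_mul_eq (pdEnd_mul_coordEnd_of_ne h1)
  simp only [X2End, mul_add, add_mul, mul_smul_comm, smul_mul_assoc, mul_assoc, c0, c1,
    pdEnd_mul_comm i]

theorem pdEnd_mul_X3End {i : Fin 5} (h0 : 0 ≠ i) (h1 : 1 ≠ i) :
    pdEnd i * X3End = X3End * pdEnd i := by
  have c0 := mul_mul_eq_of_mul_eq (pdEnd_mul_coordEnd_of_ne h0)
  have c1 := mul_mul_eq_of_mul_eq (pdEnd_mul_coordEnd_of_ne h1)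
  simp only [X3End, mul_add, add_mul, mul_assoc, c0, c1, pdEnd_mul_comm i]

theorem X3End_mul_coordEnd (j : Fin 5) (h2 : j ≠ 2) (h3 : j ≠ 3) (h4 : j ≠ 4) :
    X3End * coordEnd j = coordEnd j * X3End := by
  have c := fun i => mul_mul_eq_of_mul_eq (coordEnd_mul_comm j i)
  simp only [X3End, mul_add, add_mul, mul_assoc, c, pdEnd_mul_coordEnd_of_ne h2,
    pdEnd_mul_coordEnd_of_ne h3, pdEnd_mul_coordEnd_of_ne h4]

theorem X3End_mul_X2End : X3End * X2End = X2End * X3End - pdEnd 4 := by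
  have c0 := mul_mul_eq_of_mul_eq (X3End_mul_coordEnd 0 (by decide) (by decide) (by decide))
  have c1 := mul_mul_eq_of_mul_eq (X3End_mul_coordEnd 1 (by decide) (by decide) (by decide))
  have hp (i : Fin 5) (h0 : 0 ≠ i) (h1 : 1 ≠ i) := (pdEnd_mul_X3End h0 h1).symm
  have h1 : X3End * pdEnd 1 = pdEnd 1 * X3End - pdEnd 4 := by
    have q0 := mul_mul_eq_of_mul_eq (pdEnd_mul_coordEnd_of_ne (i := 1) (j := 0) (by decide))
    have q1 := mul_mul_eq_of_mul_eq (pdEnd_mul_coordEnd_self 1)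
    simp only [X3End, mul_add, add_mul, mul_assoc, q0, q1, one_mul, pdEnd_mul_comm 1]
    module
  simp only [X2End, mul_add, add_mul, mul_smul_comm, smul_mul_assoc, mul_assoc, c0, c1, h1,
    hp 2 (by decide) (by decide), hp 3 (by decide) (by decide), hp 4 (by decide) (by decide)]
  module

section Algebra

variable {R : Type*} [Ring R] [Algebra ℝ R]

/-- The matrix of `d_c^{(1)}` in terms of elements `a, b, c, d, e` of an algebra standing for
`X₁, …, X₅`. -/
def ruminMatrix1 (a b c d e : R) : Matrix (Fin 3) (Fin 2) R :=
  !![-(a * (a * b)) - a * c - d, a * (a * a);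
    -√2 • (a * (b * b) + e), √2 • (b * (a * a) - d);
    -(b * (b * b)), b * (b * a) - b * c - e]

/-- The matrix of `d_c^{(2)}` in terms of elements `a, b, c` of an algebra standing for
`X₁, X₂, X₃`. -/
def ruminMatrix2 (a b c : R) : Matrix (Fin 3) (Fin 3) R :=
  !![-(a * b) - c, (1 / √2) • (a * a), 0;
    -(1 / √2) • (b * b), -(3 / 2 : ℝ) • c, (1 / √2) • (a * a);
    0, -(1 / √2) • (b * b), b * a - c]

/-- The product vanishes as soon as the commutation relations of the Cartan algebra hold. -/
theorem ruminMatrix2_mul_ruminMatrix1 {a b c d e : R} (ba : b * a = a * b - c)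
    (ca : c * a = a * c - d) (cb : c * b = b * c - e) (da : d * a = a * d) (db : d * b = b * d)
    (dc : d * c = c * d) (eb : e * b = b * e) (ec : e * c = c * e) :
    ruminMatrix2 a b c * ruminMatrix1 a b c d e = 0 := by
  have hi : 1 / √2 = √2 / 2 := by
    field_simp
    norm_num
  ext1 i j
  fin_cases i <;> fin_cases j <;>
    simp only [ruminMatrix1, ruminMatrix2, Matrix.mul_apply, Fin.sum_univ_three, hi,
      Matrix.of_apply, Matrix.cons_val, Matrix.zero_apply, zero_mul, add_zero, zero_add,
      Fin.zero_eta, Fin.mk_one, Fin.reduceFinMk] <;>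
    simp only [mul_add, mul_sub, sub_mul, mul_neg, neg_mul, mul_assoc, mul_smul_comm,
      smul_mul_assoc, ba, ca, cb, da, db, dc, eb, ec, mul_mul_eq_of_mul_eq ba,
      mul_mul_eq_of_mul_eq ca, mul_mul_eq_of_mul_eq cb, mul_mul_eq_of_mul_eq da,
      mul_mul_eq_of_mul_eq db, mul_mul_eq_of_mul_eq eb] <;>
    match_scalars <;> ring_nf <;> norm_num

end Algebra

/-- The matrix of `d_c^{(1)}` over the endomorphism ring of the smooth functions. -/
def dc1End : Matrix (Fin 3) (Fin 2) (Module.End ℝ smoothFunctions) :=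
  ruminMatrix1 (pdEnd 0) X2End X3End (pdEnd 3) (pdEnd 4)

/-- The matrix of `d_c^{(2)}` over the endomorphism ring of the smooth functions. -/
def dc2End : Matrix (Fin 3) (Fin 3) (Module.End ℝ smoothFunctions) :=
  ruminMatrix2 (pdEnd 0) X2End X3End

theorem dc1_coe (i : Fin 3) (j : Fin 2) (f : smoothFunctions) :
    dc1 i j f = (dc1End i j f : smoothFunctions) := by
  fin_cases i <;> fin_cases j <;> funext x <;>
    simp [dc1, dc1End, ruminMatrix1, X1_coe, X2_coe, X3_coe, X4_coe, X5_coe, mul_add, add_comm]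

theorem dc2_coe (i j : Fin 3) (f : smoothFunctions) :
    dc2 i j f = (dc2End i j f : smoothFunctions) := by
  fin_cases i <;> fin_cases j <;> funext x <;>
    simp [dc2, dc2End, ruminMatrix2, X1_coe, X2_coe, X3_coe]

theorem dc2End_mul_dc1End : dc2End * dc1End = 0 :=
  ruminMatrix2_mul_ruminMatrix1 X2End_mul_X1 X3End_mul_X1 X3End_mul_X2End (pdEnd_mul_comm 3 0)
    (pdEnd_mul_X2End (by decide) (by decide)) (pdEnd_mul_X3End (by decide) (by decide))
    (pdEnd_mul_X2End (by decide) (by decide)) (pdEnd_mul_X3End (by decide) (by decide))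

/-- `d_c^{(2)} ∘ d_c^{(1)} = 0` on the Cartan group: the matrix product of the
two Rumin differentials is the zero 3×2 matrix of differential operators. -/
theorem stmt4 (u : Pt → ℝ) (hu : ContDiff ℝ (⊤ : ℕ∞) u) :
    ∀ (i : Fin 3) (j : Fin 2) (x : Pt),
      (∑ k : Fin 3, dc2 i k (dc1 k j u) x) = 0 := by
  intro i j x
  have h := congrArg (fun A => ((A i j ⟨u, hu⟩ : smoothFunctions) : Pt → ℝ) x) dc2End_mul_dc1End
  have hc (k : Fin 3) : dc1 k j u = (dc1End k j ⟨u, hu⟩ : smoothFunctions) := dc1_coe k j ⟨u, hu⟩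
  simp only [hc, dc2_coe]
  simpa [Matrix.mul_apply, Fin.sum_univ_three] using h
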